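/- Let μ and ν be finite positive Borel measures on ℝⁿ with the same total mass, and suppose μ ≤ ρ₀·λ and ν ≤ ρ₁·λ for constants 0 < ρ₀ < ρ₁, where λ is Lebesgue measure on ℝⁿ (i.e., μ(A) ≤ ρ₀·λ(A) and ν(A) ≤ ρ₁·λ(A) for every Borel set A). Then ‖ν − μ‖_{Ḣ⁻¹} ≤ (2(ρ₁^{1/2} − ρ₀^{1/2}) / ln(ρ₁/ρ₀)) · W₂(μ, ν). -/

import Mathlib

open MeasureTheory ENNReal

/-- The homogeneous Sobolev norm `‖ν − μ‖_{Ḣ⁻¹(lam)}` of the difference of two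
finite positive Borel measures `μ, ν` on `ℝⁿ`, with respect to a base measure `lam`. -/
noncomputable def HminusOneDiff {n : ℕ} (lam μ ν : Measure (EuclideanSpace ℝ (Fin n))) :
    ℝ≥0∞ :=
  ⨆ f ∈ {f : EuclideanSpace ℝ (Fin n) → ℝ |
      (∃ C, ∀ x, |f x| ≤ C) ∧ ContDiff ℝ 1 f ∧
      ∫⁻ x, ENNReal.ofReal (‖gradient f x‖ ^ 2) ∂lam ≤ 1},
    ENNReal.ofReal |(∫ x, f x ∂ν) - ∫ x, f x ∂μ|

/-- The quadratic Wasserstein distance `W₂(μ,ν)`, valued in `[0,∞]`. -/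
noncomputable def W2 {n : ℕ} (μ ν : Measure (EuclideanSpace ℝ (Fin n))) : ℝ≥0∞ :=
  (⨅ π ∈ {π : Measure (EuclideanSpace ℝ (Fin n) × EuclideanSpace ℝ (Fin n)) |
      π.map Prod.fst = μ ∧ π.map Prod.snd = ν},
    ∫⁻ p, ENNReal.ofReal (‖p.1 - p.2‖ ^ 2) ∂π) ^ (1/2 : ℝ)

open scoped NNReal Topology RealInnerProductSpace

section Determinant

variable {E : Type*} [NormedAddCommGroup E] [InnerProductSpace ℝ E] [FiniteDimensional ℝ E]

/-- Log-concavity of the determinant between two symmetric nonnegative operators whose convex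
combination is the identity. -/
lemma abs_det_rpow_mul_abs_det_rpow_le_one {t : ℝ} (ht0 : 0 < t) (ht1 : t < 1)
    {A B : E →L[ℝ] E} (hsymm : ∀ a b, ⟪A a, b⟫ = ⟪a, A b⟫)
    (hA : ∀ a, 0 ≤ ⟪A a, a⟫) (hB : ∀ a, 0 ≤ ⟪B a, a⟫)
    (hAB : ∀ a, (1 - t) • A a + t • B a = a) :
    |A.det| ^ (1 - t) * |B.det| ^ t ≤ 1 := by
  have hS : (A : E →ₗ[ℝ] E).IsSymmetric := fun a b => hsymm a b
  set b := hS.eigenvectorBasis rfl with hb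
  set l := hS.eigenvalues rfl with hl
  have hAb : ∀ i, A (b i) = l i • b i := fun i => by
    exact hS.apply_eigenvectorBasis rfl i
  set k : Fin (Module.finrank ℝ E) → ℝ := fun i => t⁻¹ * (1 - (1 - t) * l i) with hk
  have hBb : ∀ i, B (b i) = k i • b i := fun i => by
    have h := hAB (b i)
    rw [hAb, smul_smul] at h
    have h2 : t • B (b i) = (1 - (1 - t) * l i) • b i := by
      rw [sub_smul, one_smul]
      exact eq_sub_of_add_eq' h
    rw [hk, ← smul_smul, ← h2, smul_smul, inv_mul_cancel₀ ht0.ne', one_smul]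
  have hdet : ∀ (C : E →L[ℝ] E) (c : Fin (Module.finrank ℝ E) → ℝ),
      (∀ i, C (b i) = c i • b i) → C.det = ∏ i, c i := by
    intro C c hC
    have : LinearMap.toMatrix b.toBasis b.toBasis (C : E →ₗ[ℝ] E) = Matrix.diagonal c := by
      ext i j
      rw [LinearMap.toMatrix_apply]
      simp only [OrthonormalBasis.coe_toBasis, ContinuousLinearMap.coe_coe, hC, map_smul,
        Finsupp.smul_apply, smul_eq_mul, OrthonormalBasis.coe_toBasis_repr_apply,
        OrthonormalBasis.repr_self, Matrix.diagonal_apply]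
      by_cases hij : i = j
      · subst hij; simp
      · simp [hij]
    rw [ContinuousLinearMap.det, ← LinearMap.det_toMatrix b.toBasis, this, Matrix.det_diagonal]
  have hnn : ∀ (C : E →L[ℝ] E) (c : Fin (Module.finrank ℝ E) → ℝ),
      (∀ i, C (b i) = c i • b i) → (∀ a, 0 ≤ ⟪C a, a⟫) → ∀ i, 0 ≤ c i := by
    intro C c hC h i
    have := h (b i)
    rw [hC, inner_smul_left, real_inner_self_eq_norm_sq, b.norm_eq_one] at this
    simpa using this
  have hl0 := hnn A l hAb hA
  have hk0 := hnn B k hBb hB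
  rw [hdet A l hAb, hdet B k hBb, abs_of_nonneg (Finset.prod_nonneg fun i _ => hl0 i),
    abs_of_nonneg (Finset.prod_nonneg fun i _ => hk0 i),
    ← Real.finsetProd_rpow _ _ (fun i _ => hl0 i), ← Real.finsetProd_rpow _ _ (fun i _ => hk0 i),
    ← Finset.prod_mul_distrib]
  refine Finset.prod_le_one (fun i _ => mul_nonneg (Real.rpow_nonneg (hl0 i) _)
    (Real.rpow_nonneg (hk0 i) _)) fun i _ => ?_
  refine (Real.geom_mean_le_arith_mean2_weighted (by linarith) ht0.le (hl0 i) (hk0 i)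
    (by ring)).trans (le_of_eq ?_)
  rw [hk]
  field_simp
  ring

/-- At each point, one of the two end densities transported through `A`, `B` is controlled by the
geometric interpolation of the end densities. -/
lemma mul_abs_det_le_or_mul_abs_det_le {t : ℝ} (ht0 : 0 < t) (ht1 : t < 1)
    {A B : E →L[ℝ] E} (hsymm : ∀ a b, ⟪A a, b⟫ = ⟪a, A b⟫)
    (hA : ∀ a, 0 ≤ ⟪A a, a⟫) (hB : ∀ a, 0 ≤ ⟪B a, a⟫)
    (hAB : ∀ a, (1 - t) • A a + t • B a = a) {r s : ℝ} (hr : 0 < r) (hs : 0 < s) :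
    r * |A.det| ≤ r ^ (1 - t) * s ^ t ∨ s * |B.det| ≤ r ^ (1 - t) * s ^ t := by
  by_contra! h
  have hle := abs_det_rpow_mul_abs_det_rpow_le_one ht0 ht1 hsymm hA hB hAB
  set M := r ^ (1 - t) * s ^ t with hM
  have hM0 : 0 < M := by positivity
  have h1 : M ^ (1 - t) < (r * |A.det|) ^ (1 - t) :=
    Real.rpow_lt_rpow hM0.le h.1 (by linarith)
  have h2 : M ^ t < (s * |B.det|) ^ t := Real.rpow_lt_rpow hM0.le h.2 ht0
  have h3 := mul_lt_mul'' h1 h2 (by positivity) (by positivity)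
  rw [← Real.rpow_add hM0, Real.mul_rpow hr.le (abs_nonneg _),
    Real.mul_rpow hs.le (abs_nonneg _)] at h3
  simp only [sub_add_cancel, Real.rpow_one] at h3
  have h4 : M * (|A.det| ^ (1 - t) * |B.det| ^ t) ≤ M * 1 :=
    mul_le_mul_of_nonneg_left hle hM0.le
  rw [hM] at h3 h4
  linarith [h3, h4, mul_mul_mul_comm (r ^ (1 - t)) (|A.det| ^ (1 - t)) (s ^ t) (|B.det| ^ t)]

end Determinant

section Prox

variable {E : Type*} [NormedAddCommGroup E] [InnerProductSpace ℝ E]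

/-- The functional whose maximiser over `x` inverts the interpolation map
`(1 - t) • id + t • ∂u`. -/
noncomputable def proxFun (u : E → ℝ) (t : ℝ) (z x : E) : ℝ :=
  ⟪x, z⟫ - (1 - t) / 2 * ‖x‖ ^ 2 - t * u x

lemma exists_forall_proxFun_le [FiniteDimensional ℝ E] {u : E → ℝ} {K : ℝ≥0}
    (hu : LipschitzWith K u) {t : ℝ} (ht0 : 0 < t) (ht1 : t < 1) (z : E) :
    ∃ x, ∀ x', proxFun u t z x' ≤ proxFun u t z x := by
  have hcont : Continuous (proxFun u t z) := by
    have := hu.continuous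
    unfold proxFun
    fun_prop
  refine hcont.exists_forall_ge ?_
  have hbd : ∀ x, proxFun u t z x ≤
      ‖x‖ * ((‖z‖ + t * K) - (1 - t) / 2 * ‖x‖) - t * u 0 := fun x => by
    have h1 := real_inner_le_norm x z
    have h2 : u 0 - u x ≤ K * ‖x‖ := by
      have := hu.dist_le_mul 0 x
      rw [Real.dist_eq, dist_zero_left] at this
      exact (le_abs_self _).trans this
    unfold proxFun
    nlinarith [mul_le_mul_of_nonneg_left h2 ht0.le]
  refine Filter.tendsto_atBot_mono hbd ?_
  refine Filter.tendsto_atBot_add_const_right _ _ ?_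
  have hn := tendsto_norm_cocompact_atTop (E := E)
  refine hn.atTop_mul_atBot₀ ?_
  refine Filter.tendsto_atBot_add_const_left _ _ ?_
  exact Filter.tendsto_neg_atTop_atBot.comp (hn.const_mul_atTop (by linarith))

/-- First-order optimality condition for maximisers of `proxFun`. -/
lemma subgradient_of_forall_proxFun_le {u : E → ℝ} (hu : ConvexOn ℝ Set.univ u) {t : ℝ}
    (ht0 : 0 < t) {z x : E}
    (hx : ∀ x', proxFun u t z x' ≤ proxFun u t z x) (x' : E) :
    u x + ⟪t⁻¹ • (z - (1 - t) • x), x' - x⟫ ≤ u x' := by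
  have key : ∀ s : ℝ, 0 < s → s < 1 →
      ⟪z, x' - x⟫ - (1 - t) * ⟪x, x' - x⟫ - t * (u x' - u x) ≤
        s * ((1 - t) / 2 * ‖x' - x‖ ^ 2) := by
    intro s hs0 hs1
    have h1 := hx (x + s • (x' - x))
    have h2 := hu.2 (Set.mem_univ x) (Set.mem_univ x') (by linarith : 0 ≤ 1 - s) hs0.le (by ring)
    have h3 : (1 - s) • x + s • x' = x + s • (x' - x) := by module
    rw [h3, smul_eq_mul, smul_eq_mul] at h2
    unfold proxFun at h1
    rw [inner_add_left, real_inner_smul_left, norm_add_sq_real, real_inner_smul_right,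
      norm_smul, Real.norm_eq_abs, mul_pow, sq_abs, real_inner_comm z] at h1
    have h4 := mul_le_mul_of_nonneg_left h2 ht0.le
    have h5 : s * (⟪z, x' - x⟫ - (1 - t) * ⟪x, x' - x⟫ - t * (u x' - u x)) ≤
        s * (s * ((1 - t) / 2 * ‖x' - x‖ ^ 2)) := by
      have hc : ⟪x' - x, z⟫ = ⟪z, x' - x⟫ := real_inner_comm _ _
      rw [hc] at h1
      nlinarith
    exact le_of_mul_le_mul_left h5 hs0
  have hlim : Filter.Tendsto (fun s : ℝ => s * ((1 - t) / 2 * ‖x' - x‖ ^ 2)) (𝓝[>] 0) (𝓝 0) := by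
    have : Filter.Tendsto (fun s : ℝ => s * ((1 - t) / 2 * ‖x' - x‖ ^ 2)) (𝓝 0)
      (𝓝 (0 * ((1 - t) / 2 * ‖x' - x‖ ^ 2))) := Filter.Tendsto.mul_const _ Filter.tendsto_id
    rw [zero_mul] at this
    exact this.mono_left nhdsWithin_le_nhds
  have h0 := ge_of_tendsto hlim (by
    filter_upwards [Ioo_mem_nhdsGT (zero_lt_one' ℝ)] with s hs using key s hs.1 hs.2)
  rw [real_inner_smul_left, inner_sub_left, real_inner_smul_left]
  have : t⁻¹ * (⟪z, x' - x⟫ - (1 - t) * ⟪x, x' - x⟫) ≤ t⁻¹ * (t * (u x' - u x)) :=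
    mul_le_mul_of_nonneg_left (by linarith) (by positivity)
  rw [inv_mul_cancel_left₀ ht0.ne'] at this
  linarith

/-- If `X z` is the starting point of a segment passing through `z` at time `t`, then
`proxEnd X t z` is its end point. -/
noncomputable def proxEnd (X : E → E) (t : ℝ) (z : E) : E := t⁻¹ • (z - (1 - t) • X z)

variable {u : E → ℝ} {t : ℝ} {X : E → E}

lemma smul_add_smul_proxEnd (ht0 : 0 < t) (z : E) :
    (1 - t) • X z + t • proxEnd X t z = z := by
  rw [proxEnd, smul_smul, mul_inv_cancel₀ ht0.ne', one_smul]
  abel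

lemma inner_proxEnd_sub_nonneg
    (hX : ∀ z x', u (X z) + ⟪proxEnd X t z, x' - X z⟫ ≤ u x') (z z' : E) :
    0 ≤ ⟪proxEnd X t z' - proxEnd X t z, X z' - X z⟫ := by
  have h1 := hX z (X z')
  have h2 := hX z' (X z)
  rw [← neg_sub (X z') (X z), inner_neg_right] at h2
  rw [inner_sub_left]
  linarith

lemma sub_eq_smul_add_smul (ht0 : 0 < t) (z z' : E) :
    z' - z = (1 - t) • (X z' - X z) + t • (proxEnd X t z' - proxEnd X t z) := by
  conv_lhs => rw [← smul_add_smul_proxEnd (X := X) ht0 z, ← smul_add_smul_proxEnd (X := X) ht0 z']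
  module

lemma mul_norm_sub_sq_le (ht0 : 0 < t)
    (hX : ∀ z x', u (X z) + ⟪proxEnd X t z, x' - X z⟫ ≤ u x') (z z' : E) :
    (1 - t) * ‖X z' - X z‖ ^ 2 ≤ ⟪X z' - X z, z' - z⟫ := by
  rw [sub_eq_smul_add_smul (X := X) ht0 z z', inner_add_right, real_inner_smul_right,
    real_inner_smul_right, real_inner_self_eq_norm_sq, real_inner_comm _ (X z' - X z)]
  have := mul_nonneg ht0.le (inner_proxEnd_sub_nonneg hX z z')
  linarith

lemma mul_norm_proxEnd_sub_sq_le (ht0 : 0 < t) (ht1 : t < 1)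
    (hX : ∀ z x', u (X z) + ⟪proxEnd X t z, x' - X z⟫ ≤ u x') (z z' : E) :
    t * ‖proxEnd X t z' - proxEnd X t z‖ ^ 2 ≤ ⟪proxEnd X t z' - proxEnd X t z, z' - z⟫ := by
  conv_rhs => rw [sub_eq_smul_add_smul (X := X) ht0 z z', inner_add_right, real_inner_smul_right,
    real_inner_smul_right, real_inner_self_eq_norm_sq]
  have := mul_nonneg (by linarith : 0 ≤ 1 - t) (inner_proxEnd_sub_nonneg hX z z')
  linarith

lemma lipschitzWith_of_mul_norm_sub_sq_le {c : ℝ} (hc : 0 < c) {F : E → E}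
    (hF : ∀ z z', c * ‖F z' - F z‖ ^ 2 ≤ ⟪F z' - F z, z' - z⟫) :
    LipschitzWith (Real.toNNReal c⁻¹) F := by
  refine LipschitzWith.of_dist_le_mul fun z' z => ?_
  rw [dist_eq_norm, dist_eq_norm, Real.coe_toNNReal _ (by positivity)]
  have h := (hF z z').trans (real_inner_le_norm _ _)
  rw [inv_mul_eq_div, le_div_iff₀ hc]
  rcases (norm_nonneg (F z' - F z)).eq_or_lt with h0 | h0
  · rw [← h0]; simp
  · refine le_of_mul_le_mul_left ?_ h0
    linarith [h]

/-- The starting point of a segment is recovered from its position at time `t`. -/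
lemma prox_eq_of_subgradient (ht0 : 0 < t) (ht1 : t < 1)
    (hX : ∀ z x', u (X z) + ⟪proxEnd X t z, x' - X z⟫ ≤ u x') {x y : E}
    (hxy : ∀ x', u x + ⟪y, x' - x⟫ ≤ u x') :
    X ((1 - t) • x + t • y) = x := by
  set z := (1 - t) • x + t • y with hz
  have h1 := hX z x
  have h2 := hxy (X z)
  rw [← neg_sub x (X z), inner_neg_right] at h2
  have h3 : proxEnd X t z - y = (t⁻¹ * (1 - t)) • (x - X z) := by
    rw [proxEnd, mul_smul, eq_inv_smul_iff₀ ht0.ne', smul_sub, smul_smul,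
      mul_inv_cancel₀ ht0.ne', hz]
    module
  have h4 : ⟪proxEnd X t z - y, x - X z⟫ ≤ 0 := by rw [inner_sub_left]; linarith
  rw [h3, real_inner_smul_left, real_inner_self_eq_norm_sq] at h4
  have h5 : 0 < t⁻¹ * (1 - t) := mul_pos (by positivity) (by linarith)
  have h6 : ‖x - X z‖ ^ 2 ≤ 0 := by
    by_contra! h
    linarith [mul_pos h5 h]
  have h7 : ‖x - X z‖ = 0 := by nlinarith [norm_nonneg (x - X z)]
  exact (sub_eq_zero.1 (norm_eq_zero.1 h7)).symm

lemma hasFDerivAt_proxFun {c : ℝ} (hc : 0 < c)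
    (hmax : ∀ z x', proxFun u t z x' ≤ proxFun u t z (X z))
    (hF : ∀ z z', c * ‖X z' - X z‖ ^ 2 ≤ ⟪X z' - X z, z' - z⟫) (z : E) :
    HasFDerivAt (fun z => proxFun u t z (X z)) (innerSL ℝ (X z)) z := by
  have hlip := lipschitzWith_of_mul_norm_sub_sq_le hc hF
  rw [hasFDerivAt_iff_isLittleO]
  have hb : ∀ z', ‖proxFun u t z' (X z') - proxFun u t z (X z) - innerSL ℝ (X z) (z' - z)‖ ≤
      c⁻¹ * ‖‖z' - z‖ ^ 2‖ := by
    intro z'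
    have h1 := hmax z' (X z)
    have h2 := hmax z (X z')
    have h3 : ⟪X z' - X z, z' - z⟫ ≤ c⁻¹ * ‖z' - z‖ ^ 2 := by
      have := hlip.dist_le_mul z' z
      rw [dist_eq_norm, dist_eq_norm, Real.coe_toNNReal _ (by positivity)] at this
      refine (real_inner_le_norm _ _).trans ?_
      nlinarith [norm_nonneg (z' - z)]
    unfold proxFun at h1 h2 ⊢
    simp only [inner_sub_left, inner_sub_right, innerSL_apply_apply] at h3 ⊢
    rw [norm_pow, norm_norm, Real.norm_eq_abs, abs_le]
    have h4 : 0 ≤ c⁻¹ * ‖z' - z‖ ^ 2 := by positivity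
    constructor <;> linarith
  refine (Asymptotics.IsBigO.of_bound _ (Filter.Eventually.of_forall hb)).trans_isLittleO ?_
  have : (fun z' => ‖z' - z‖ ^ 2) =o[𝓝 z] fun z' => z' - z := by
    have h := (Asymptotics.isLittleO_norm_pow_id (E' := E) one_lt_two).comp_tendsto
      (tendsto_sub_nhds_zero_iff.2 (Filter.tendsto_id (x := 𝓝 z)))
    exact h
  exact this

lemma inner_fderiv_comm (hw : ∀ z, HasFDerivAt (fun z => proxFun u t z (X z)) (innerSL ℝ (X z)) z)
    {z : E} (hz : DifferentiableAt ℝ X z) (a b : E) :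
    ⟪fderiv ℝ X z a, b⟫ = ⟪a, fderiv ℝ X z b⟫ := by
  have h : HasFDerivAt (fun z => (innerSL ℝ (X z) : E →L[ℝ] ℝ))
      ((innerSL ℝ : E →L[ℝ] E →L[ℝ] ℝ).comp (fderiv ℝ X z)) z :=
    (innerSL ℝ : E →L[ℝ] E →L[ℝ] ℝ).hasFDerivAt.comp z hz.hasFDerivAt
  have := second_derivative_symmetric hw h a b
  simp only [ContinuousLinearMap.comp_apply, innerSL_apply_apply] at this
  rw [this, real_inner_comm]

lemma inner_fderiv_nonneg {F : E → E} (hF : ∀ z z', 0 ≤ ⟪F z' - F z, z' - z⟫) {z : E}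
    (hz : DifferentiableAt ℝ F z) (a : E) : 0 ≤ ⟪fderiv ℝ F z a, a⟫ := by
  have h := hz.hasFDerivAt.hasLineDerivAt a
  have hsub : Set.Ioi (0 : ℝ) ⊆ {0}ᶜ := fun s hs => ne_of_gt hs
  have h2 := (hasDerivAt_iff_tendsto_slope.1 h).mono_left (nhdsWithin_mono 0 hsub)
  have h3 := Filter.Tendsto.inner (𝕜 := ℝ) h2 (tendsto_const_nhds (x := a))
  refine ge_of_tendsto h3 ?_
  filter_upwards [self_mem_nhdsWithin] with s hs
  have hs : 0 < s := hs
  have := hF z (z + s • a)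
  rw [add_sub_cancel_left, real_inner_smul_right] at this
  rw [slope_def_module]
  simp only [sub_zero, zero_smul, add_zero, real_inner_smul_left]
  have h5 := nonneg_of_mul_nonneg_right this hs
  positivity

end Prox

section Density

variable {E : Type*} [NormedAddCommGroup E] [InnerProductSpace ℝ E] [FiniteDimensional ℝ E]
  [MeasurableSpace E] [BorelSpace E]

lemma LipschitzWith.addHaar_image_eq_zero {m : Measure E} [m.IsAddHaarMeasure] {K : ℝ≥0}
    {F : E → E} (hF : LipschitzWith K F) {s : Set E} (hs : m s = 0) : m (F '' s) = 0 := by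
  suffices h : μH[Module.finrank ℝ E] (F '' s) = 0 from
    Measure.absolutelyContinuous_isAddHaarMeasure m (μH[Module.finrank ℝ E]) h
  have h0 : μH[Module.finrank ℝ E] s = 0 :=
    Measure.absolutelyContinuous_isAddHaarMeasure (μH[Module.finrank ℝ E]) m hs
  refine le_antisymm ((hF.hausdorffMeasure_image_le (Nat.cast_nonneg _) s).trans ?_) zero_le
  rw [h0, mul_zero]

lemma measure_image_le_of_mul_abs_det_le {m μ : Measure E} [m.IsAddHaarMeasure] {r M : ℝ}
    (hr : 0 ≤ r) (hμ : μ ≤ ENNReal.ofReal r • m) {F : E → E} {s : Set E}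
    (hs : MeasurableSet s) (hF : ∀ z ∈ s, DifferentiableAt ℝ F z)
    (hdet : ∀ z ∈ s, r * |(fderiv ℝ F z).det| ≤ M) :
    μ (F '' s) ≤ ENNReal.ofReal M * m s := by
  calc μ (F '' s) ≤ ENNReal.ofReal r * m (F '' s) := by
        simpa using hμ (F '' s)
    _ ≤ ENNReal.ofReal r * ∫⁻ z in s, ENNReal.ofReal |(fderiv ℝ F z).det| ∂m := by
        gcongr
        exact addHaar_image_le_lintegral_abs_det_fderiv m hs fun z hz =>
          (hF z hz).hasFDerivAt.hasFDerivWithinAt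
    _ = ∫⁻ z in s, ENNReal.ofReal (r * |(fderiv ℝ F z).det|) ∂m := by
        rw [← lintegral_const_mul' _ _ ENNReal.ofReal_ne_top]
        simp_rw [ENNReal.ofReal_mul hr]
    _ ≤ ∫⁻ _ in s, ENNReal.ofReal M ∂m :=
        setLIntegral_mono measurable_const fun z hz => ENNReal.ofReal_le_ofReal (hdet z hz)
    _ = ENNReal.ofReal M * m s := setLIntegral_const _ _

/-- Along the displacement interpolation driven by a convex potential, density upper bounds
interpolate geometrically. -/
theorem measure_interpolation_preimage_le {m μ ν : Measure E} [m.IsAddHaarMeasure] {r s : ℝ}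
    (hr : 0 < r) (hs : 0 < s) (hμ : μ ≤ ENNReal.ofReal r • m) (hν : ν ≤ ENNReal.ofReal s • m)
    {u : E → ℝ} {K : ℝ≥0} (hconv : ConvexOn ℝ Set.univ u) (hlip : LipschitzWith K u)
    {T : E → E} (hT : Measurable T) (hmap : μ.map T = ν)
    (hsub : ∀ᵐ x ∂μ, ∀ x', u x + ⟪T x, x' - x⟫ ≤ u x')
    {t : ℝ} (ht0 : 0 < t) (ht1 : t < 1) {A : Set E} (hA : MeasurableSet A) :
    μ ((fun x => (1 - t) • x + t • T x) ⁻¹' A) ≤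
      ENNReal.ofReal (r ^ (1 - t) * s ^ t) * m A := by
  choose X hmax using exists_forall_proxFun_le hlip ht0 ht1
  have hX : ∀ z x', u (X z) + ⟪proxEnd X t z, x' - X z⟫ ≤ u x' := fun z x' =>
    subgradient_of_forall_proxFun_le hconv ht0 (hmax z) x'
  have ht1' : 0 < 1 - t := by linarith
  set Y := proxEnd X t with hY
  have hXm := mul_norm_sub_sq_le ht0 hX
  have hYm := mul_norm_proxEnd_sub_sq_le ht0 ht1 hX
  have hXlip := lipschitzWith_of_mul_norm_sub_sq_le ht1' hXm
  have hw := hasFDerivAt_proxFun ht1' hmax hXm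
  have hYd : ∀ z, DifferentiableAt ℝ X z → DifferentiableAt ℝ Y z := fun z hz =>
    (differentiableAt_id.sub (hz.const_smul (1 - t))).const_smul t⁻¹
  set M := r ^ (1 - t) * s ^ t with hM
  set D := {z | DifferentiableAt ℝ X z} with hD
  have hDm : MeasurableSet D := measurableSet_of_differentiableAt ℝ X
  have hDnull : m Dᶜ = 0 := hXlip.ae_differentiableAt
  set P := {z | r * |(fderiv ℝ X z).det| ≤ M} with hP
  have hPm : MeasurableSet P := by
    refine measurableSet_le ?_ measurable_const
    exact (measurable_const.mul
      ((ContinuousLinearMap.continuous_det.measurable.comp (measurable_fderiv ℝ X)).abs))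
  have hdet : ∀ z ∈ D \ P, s * |(fderiv ℝ Y z).det| ≤ M := by
    rintro z ⟨hzD, hzP⟩
    refine (mul_abs_det_le_or_mul_abs_det_le ht0 ht1 (inner_fderiv_comm hw hzD)
      (inner_fderiv_nonneg (fun z z' => le_trans (by positivity) (hXm z z')) hzD)
      (inner_fderiv_nonneg (fun z z' => le_trans (by positivity) (hYm z z')) (hYd z hzD))
      (fun a => ?_) hr hs).resolve_left hzP
    have h1 : HasFDerivAt (fun z => (1 - t) • X z + t • Y z)
        ((1 - t) • fderiv ℝ X z + t • fderiv ℝ Y z) z :=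
      (hzD.hasFDerivAt.const_smul _).add ((hYd z hzD).hasFDerivAt.const_smul _)
    have h2 : (fun z => (1 - t) • X z + t • Y z) = id :=
      funext fun z => smul_add_smul_proxEnd ht0 z
    rw [h2] at h1
    simpa using congrArg (fun L : E →L[ℝ] E => L a) (h1.unique (hasFDerivAt_id z))
  set Z := fun x => (1 - t) • x + t • T x with hZ
  have hrec : ∀ᵐ x ∂μ, X (Z x) = x ∧ Y (Z x) = T x := by
    filter_upwards [hsub] with x hx
    have h1 : X (Z x) = x := prox_eq_of_subgradient ht0 ht1 hX hx
    refine ⟨h1, ?_⟩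
    rw [hY, proxEnd, h1, hZ, add_sub_cancel_left, smul_smul, inv_mul_cancel₀ ht0.ne', one_smul]
  have hμac : ∀ S : Set E, m S = 0 → μ S = 0 := fun S hS => by
    have := hμ S
    simpa [hS] using this
  have hcover : Z ⁻¹' A ≤ᵐ[μ]
      (X '' (A ∩ D ∩ P) ∪ T ⁻¹' (Y '' ((A ∩ D) \ P)) ∪ X '' (Dᶜ) : Set E) := by
    filter_upwards [hrec] with x hx hxA
    have hxA : Z x ∈ A := hxA
    by_cases hxD : Z x ∈ D
    · by_cases hxP : Z x ∈ P
      · exact Or.inl (Or.inl ⟨Z x, ⟨⟨hxA, hxD⟩, hxP⟩, hx.1⟩)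
      · exact Or.inl (Or.inr ⟨Z x, ⟨⟨hxA, hxD⟩, hxP⟩, hx.2⟩)
    · exact Or.inr ⟨Z x, hxD, hx.1⟩
  calc μ (Z ⁻¹' A) ≤ μ (X '' (A ∩ D ∩ P) ∪ T ⁻¹' (Y '' ((A ∩ D) \ P)) ∪ X '' (Dᶜ)) :=
        measure_mono_ae hcover
    _ ≤ μ (X '' (A ∩ D ∩ P)) + μ (T ⁻¹' (Y '' ((A ∩ D) \ P))) + μ (X '' (Dᶜ)) :=
        (measure_union_le _ _).trans (add_le_add_left (measure_union_le _ _) _)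
    _ = μ (X '' (A ∩ D ∩ P)) + μ (T ⁻¹' (Y '' ((A ∩ D) \ P))) := by
        rw [hμac _ (hXlip.addHaar_image_eq_zero hDnull), add_zero]
    _ ≤ ENNReal.ofReal M * m (A ∩ D ∩ P) + ENNReal.ofReal M * m ((A ∩ D) \ P) := by
        refine add_le_add ?_ ?_
        · exact measure_image_le_of_mul_abs_det_le hr.le hμ ((hA.inter hDm).inter hPm)
            (fun z hz => hz.1.2) (fun z hz => hz.2)
        · refine (Measure.le_map_apply hT.aemeasurable _).trans ?_
          rw [hmap]
          exact measure_image_le_of_mul_abs_det_le hs.le hν ((hA.inter hDm).diff hPm)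
            (fun z hz => hYd z hz.1.2) (fun z hz => hdet z ⟨hz.1.2, hz.2⟩)
    _ = ENNReal.ofReal M * m (A ∩ D) := by
        rw [← mul_add, measure_inter_add_sdiff _ hPm]
    _ ≤ ENNReal.ofReal M * m A := by gcongr; exact Set.inter_subset_left

end Density

section Support

variable {E : Type*} [NormedAddCommGroup E] [MeasurableSpace E] [BorelSpace E] {K : Set E}

lemma integrable_of_continuous_of_ae_mem [SecondCountableTopology E]
    {μ : Measure E} [IsFiniteMeasure μ]
    (hK : IsCompact K) (hμ : ∀ᵐ x ∂μ, x ∈ K)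
    {f : E → ℝ} (hf : Continuous f) : Integrable f μ := by
  have h := hf.continuousOn.integrableOn_compact (μ := μ) hK
  rwa [IntegrableOn, Measure.restrict_eq_self_of_ae_mem hμ] at h

lemma isFiniteMeasure_comap_coe [CompactSpace K] {ν : Measure E} [IsFiniteMeasure ν] :
    IsFiniteMeasure (ν.comap ((↑) : K → E)) := by
  have hK : IsCompact K := isCompact_iff_compactSpace.2 inferInstance
  constructor
  rw [(MeasurableEmbedding.subtype_coe hK.measurableSet).comap_apply]
  exact measure_lt_top _ _

lemma integral_comap_coe_eq {α : Type*} [MeasurableSpace α] {K : Set α} {ν : Measure α}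
    (hK : MeasurableSet K) (hν : ∀ᵐ x ∂ν, x ∈ K) (f : α → ℝ) :
    ∫ y : K, f y ∂(ν.comap ((↑) : K → α)) = ∫ y, f y ∂ν := by
  rw [integral_subtype_comap hK, Measure.restrict_eq_self_of_ae_mem hν]

end Support

section Kantorovich

variable {E : Type*} [NormedAddCommGroup E] [InnerProductSpace ℝ E] {K : Set E}

/-- The convex conjugate of a function defined on `K`. -/
noncomputable def convexConj (g : K → ℝ) (x : E) : ℝ := ⨆ y : K, (⟪x, (y : E)⟫ - g y)

lemma exists_convexConj_eq [CompactSpace K] [Nonempty K] {g : K → ℝ} (hg : Continuous g) (x : E) :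
    ∃ y : K, convexConj g x = ⟪x, (y : E)⟫ - g y ∧
      ∀ y' : K, ⟪x, (y' : E)⟫ - g y' ≤ ⟪x, (y : E)⟫ - g y := by
  have hc : Continuous fun y : K => ⟪x, (y : E)⟫ - g y := by fun_prop
  obtain ⟨y, hy⟩ := hc.exists_forall_ge_of_hasCompactSupport
    (HasCompactSupport.of_compactSpace _)
  exact ⟨y, le_antisymm (ciSup_le hy) (le_ciSup ⟨_, Set.forall_mem_range.2 hy⟩ y), hy⟩

lemma inner_sub_le_convexConj [CompactSpace K] {g : K → ℝ} (hg : Continuous g) (x : E) (y : K) :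
    ⟪x, (y : E)⟫ - g y ≤ convexConj g x := by
  have : Nonempty K := ⟨y⟩
  obtain ⟨y', h1, h2⟩ := exists_convexConj_eq hg x
  exact (h2 y).trans h1.ge

lemma subgradient_convexConj [CompactSpace K] {g : K → ℝ} (hg : Continuous g) {x : E} {y : K}
    (hy : convexConj g x = ⟪x, (y : E)⟫ - g y) (x' : E) :
    convexConj g x + ⟪(y : E), x' - x⟫ ≤ convexConj g x' := by
  have h := inner_sub_le_convexConj hg x' y
  rw [inner_sub_right, real_inner_comm x', real_inner_comm x]
  linarith

variable [CompactSpace K] [Nonempty K] {g g' : K → ℝ}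

lemma convexConj_le_add (hg : Continuous g) (hg' : Continuous g') {δ : ℝ}
    (h : ∀ y, g' y ≤ g y + δ) (x : E) : convexConj g x ≤ convexConj g' x + δ := by
  obtain ⟨y, hy, -⟩ := exists_convexConj_eq hg x
  linarith [inner_sub_le_convexConj hg' x y, h y]

lemma lipschitzWith_convexConj (hg : Continuous g) {R : ℝ≥0} (hR : ∀ y ∈ K, ‖y‖ ≤ R) :
    LipschitzWith R (convexConj g) := by
  refine LipschitzWith.of_le_add_mul R fun x x' => ?_
  obtain ⟨y, hy, -⟩ := exists_convexConj_eq hg x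
  have h1 := inner_sub_le_convexConj hg x' y
  have h2 : ⟪x - x', (y : E)⟫ ≤ R * dist x x' := by
    rw [dist_eq_norm, mul_comm]
    exact (real_inner_le_norm _ _).trans (mul_le_mul_of_nonneg_left (hR y y.2) (norm_nonneg _))
  rw [inner_sub_left] at h2
  linarith

lemma convexOn_convexConj (hg : Continuous g) : ConvexOn ℝ Set.univ (convexConj g) := by
  refine ⟨convex_univ, fun x _ x' _ a b ha hb hab => ?_⟩
  obtain ⟨y, hy, -⟩ := exists_convexConj_eq hg (a • x + b • x')
  rw [hy, inner_add_left, real_inner_smul_left, real_inner_smul_left, smul_eq_mul, smul_eq_mul]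
  have h1 := mul_le_mul_of_nonneg_left (inner_sub_le_convexConj hg x y) ha
  have h2 := mul_le_mul_of_nonneg_left (inner_sub_le_convexConj hg x' y) hb
  have h3 : g y = a * g y + b * g y := by rw [← add_mul, hab, one_mul]
  linarith

lemma continuous_convexConj (hg : Continuous g) : Continuous (convexConj g) := by
  have hK : IsCompact K := isCompact_iff_compactSpace.2 inferInstance
  obtain ⟨R, hR⟩ := hK.isBounded.exists_norm_le
  exact (lipschitzWith_convexConj (R := R.toNNReal) hg
    fun y hy => (hR y hy).trans (Real.le_coe_toNNReal R)).continuous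

variable [MeasurableSpace E] [BorelSpace E]

/-- The dual Kantorovich functional. -/
noncomputable def dualFun (μ ν : Measure E) (g : K → ℝ) : ℝ :=
  ∫ x, convexConj g x ∂μ + ∫ y, g y ∂(ν.comap ((↑) : K → E))

variable [FiniteDimensional ℝ E] {μ ν : Measure E} [IsFiniteMeasure μ] [IsFiniteMeasure ν]

lemma dualFun_le_add (hμ : ∀ᵐ x ∂μ, x ∈ K) (hg : Continuous g) (hg' : Continuous g') {a b : ℝ}
    (h1 : ∀ x ∈ K, convexConj g x ≤ convexConj g' x + a) (h2 : ∀ y, g y ≤ g' y + b) :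
    dualFun μ ν g ≤ dualFun μ ν g' +
      (a * μ.real Set.univ + b * (ν.comap ((↑) : K → E)).real Set.univ) := by
  have hK : IsCompact K := isCompact_iff_compactSpace.2 inferInstance
  have := isFiniteMeasure_comap_coe (K := K) (ν := ν)
  have hi : ∀ {f : K → ℝ}, Continuous f → Integrable f (ν.comap ((↑) : K → E)) := fun hf =>
    hf.integrable_of_hasCompactSupport (HasCompactSupport.of_compactSpace _)
  have hj := fun {f : E → ℝ} (hf : Continuous f) => integrable_of_continuous_of_ae_mem hK hμ hf
  have e1 : ∫ x, convexConj g x ∂μ ≤ ∫ x, (convexConj g' x + a) ∂μ :=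
    integral_mono_ae (hj (continuous_convexConj hg))
      ((hj (continuous_convexConj hg')).add (integrable_const _)) (hμ.mono h1)
  have e2 : ∫ y, g y ∂(ν.comap ((↑) : K → E)) ≤ ∫ y, (g' y + b) ∂(ν.comap ((↑) : K → E)) :=
    integral_mono (hi hg) ((hi hg').add (integrable_const _)) h2
  rw [integral_add (hj (continuous_convexConj hg')) (integrable_const _), integral_const,
    smul_eq_mul] at e1
  rw [integral_add (hi hg') (integrable_const _), integral_const, smul_eq_mul] at e2
  unfold dualFun
  linarith

/-- Replacing a potential by its normalised double conjugate does not increase the dual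
functional and makes the potential Lipschitz. -/
lemma exists_lipschitz_dualFun_le (hμ : ∀ᵐ x ∂μ, x ∈ K)
    (hmass : μ.real Set.univ = (ν.comap ((↑) : K → E)).real Set.univ) {R : ℝ≥0}
    (hR : ∀ y ∈ K, ‖y‖ ≤ R) (y₀ : K) (hg : Continuous g) :
    ∃ g' : K → ℝ, LipschitzWith R g' ∧ g' y₀ = 0 ∧ dualFun μ ν g' ≤ dualFun μ ν g := by
  set k : K → ℝ := fun x => convexConj g x with hk
  have hkc : Continuous k := (continuous_convexConj hg).comp continuous_subtype_val
  set c := convexConj k y₀ with hc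
  have hLip : LipschitzWith R (fun y : K => convexConj k y - c) := by
    refine LipschitzWith.of_dist_le_mul fun y y' => ?_
    rw [dist_sub_right]
    exact (lipschitzWith_convexConj hkc hR).dist_le_mul y y'
  refine ⟨fun y => convexConj k y - c, hLip, sub_self _, ?_⟩
  have h := dualFun_le_add (μ := μ) (ν := ν) (g := fun y : K => convexConj k y - c) (g' := g)
    (a := c) (b := -c) hμ hLip.continuous hg ?_ ?_
  · rw [hmass] at h
    linarith
  · intro x hx
    obtain ⟨y, hy, -⟩ := exists_convexConj_eq hLip.continuous x
    have h1 := inner_sub_le_convexConj hkc (y : E) ⟨x, hx⟩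
    rw [real_inner_comm] at h1
    simp only [hk] at h1
    rw [hy]
    linarith
  · intro y
    obtain ⟨x, hx, -⟩ := exists_convexConj_eq hkc (y : E)
    have h1 := inner_sub_le_convexConj hg (x : E) y
    rw [real_inner_comm] at h1
    rw [hx]
    simp only [hk]
    linarith

/-- Existence of a minimiser of the dual Kantorovich functional on a compact set. -/
lemma exists_forall_dualFun_le (hμ : ∀ᵐ x ∂μ, x ∈ K)
    (hmass : μ.real Set.univ = (ν.comap ((↑) : K → E)).real Set.univ) :
    ∃ g : K → ℝ, Continuous g ∧ ∀ g' : K → ℝ, Continuous g' → dualFun μ ν g ≤ dualFun μ ν g' := by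
  have hK : IsCompact K := isCompact_iff_compactSpace.2 inferInstance
  obtain ⟨R', hR'⟩ := hK.isBounded.exists_norm_le
  set R := R'.toNNReal
  have hR : ∀ y ∈ K, ‖y‖ ≤ R := fun y hy => (hR' y hy).trans (Real.le_coe_toNNReal R')
  obtain ⟨y₀⟩ := ‹Nonempty K›
  set A : Set (BoundedContinuousFunction K ℝ) := {g | LipschitzWith R g ∧ g y₀ = 0} with hA
  have hAclosed : IsClosed A := by
    have : A = (⋂ y, ⋂ y', {g : BoundedContinuousFunction K ℝ | dist (g y) (g y') ≤ R * dist y y'})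
        ∩ {g | g y₀ = 0} := by
      ext g
      simp [hA, lipschitzWith_iff_dist_le_mul]
    rw [this]
    refine IsClosed.inter (isClosed_iInter fun y => isClosed_iInter fun y' => ?_) ?_
    · exact isClosed_le ((continuous_eval_const _).dist
        (continuous_eval_const _)) continuous_const
    · exact isClosed_eq (continuous_eval_const _) continuous_const
  have hAcomp : IsCompact A := by
    refine BoundedContinuousFunction.arzela_ascoli₂ (Metric.closedBall 0 (R * Metric.diam K))
      (isCompact_closedBall _ _) A hAclosed ?_ ?_
    · intro g y hg
      rw [mem_closedBall_zero_iff, ← sub_zero (g y), ← hg.2, ← dist_eq_norm]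
      refine (hg.1.dist_le_mul y y₀).trans ?_
      gcongr
      exact Metric.dist_le_diam_of_mem hK.isBounded y.2 y₀.2
    · exact (LipschitzWith.uniformEquicontinuous _ R fun g : A => g.2.1).equicontinuous
  have : Nonempty K := ⟨y₀⟩
  have hcont : Continuous fun g : BoundedContinuousFunction K ℝ => dualFun μ ν g := by
    refine (LipschitzWith.of_le_add_mul' (μ.real Set.univ +
      (ν.comap ((↑) : K → E)).real Set.univ) fun g g' => ?_).continuous
    have hd : ∀ y, |g y - g' y| ≤ dist g g' := fun y => by
      rw [← Real.dist_eq]; exact BoundedContinuousFunction.dist_coe_le_dist y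
    have := dualFun_le_add (μ := μ) (ν := ν) (a := dist g g') (b := dist g g') hμ g.continuous
      g'.continuous
      (fun x _ => convexConj_le_add g.continuous g'.continuous
        (fun y => by linarith [(abs_le.1 (hd y)).1]) x)
      (fun y => by linarith [(abs_le.1 (hd y)).2])
    linarith
  obtain ⟨g, hgA, hg⟩ := hAcomp.exists_isMinOn
    ⟨0, by refine ⟨?_, rfl⟩; exact (LipschitzWith.const (0 : ℝ)).weaken zero_le⟩
    hcont.continuousOn
  refine ⟨g, g.continuous, fun g' hg' => ?_⟩
  obtain ⟨g₁, h1, h2, h3⟩ := exists_lipschitz_dualFun_le hμ hmass hR y₀ hg'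
  exact (hg (show BoundedContinuousFunction.mkOfCompact ⟨g₁, h1.continuous⟩ ∈ A from
    ⟨h1, h2⟩)).trans h3

end Kantorovich

section OptimalMap

variable {E : Type*} [NormedAddCommGroup E] [InnerProductSpace ℝ E] [FiniteDimensional ℝ E]
  {K : Set E} [CompactSpace K] [Nonempty K]

omit [Nonempty K] in
/-- At a differentiability point of the conjugate, the maximiser is the gradient. -/
lemma gradient_convexConj_eq {g : K → ℝ} (hg : Continuous g) {x : E}
    (hx : DifferentiableAt ℝ (convexConj g) x) {y : K}
    (hy : convexConj g x = ⟪x, (y : E)⟫ - g y) : gradient (convexConj g) x = y := by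
  have hmin : IsLocalMin (fun x' => convexConj g x' - innerSL ℝ (y : E) x') x := by
    refine Filter.Eventually.of_forall fun x' => ?_
    have := subgradient_convexConj hg hy x'
    rw [inner_sub_right] at this
    simp only [innerSL_apply_apply]
    linarith
  have h := hmin.hasFDerivAt_eq_zero (hx.hasFDerivAt.sub (innerSL ℝ (y : E)).hasFDerivAt)
  rw [sub_eq_zero] at h
  rw [gradient, h, LinearIsometryEquiv.symm_apply_eq]
  ext z
  simp

omit [FiniteDimensional ℝ E] in
/-- The derivative of the conjugate under a perturbation of the potential. -/
lemma tendsto_convexConj_add_sub_div {g h : K → ℝ} (hg : Continuous g) (hh : Continuous h) {x : E}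
    {y : K} (hy : convexConj g x = ⟪x, (y : E)⟫ - g y)
    (huniq : ∀ y' : K, convexConj g x = ⟪x, (y' : E)⟫ - g y' → y' = y)
    {ε : ℕ → ℝ} (hε : ∀ k, 0 < ε k) (hlim : Filter.Tendsto ε Filter.atTop (𝓝 0)) :
    Filter.Tendsto (fun k => (convexConj (fun z => g z + ε k * h z) x - convexConj g x) / ε k)
      Filter.atTop (𝓝 (-h y)) := by
  have hgε : ∀ k, Continuous fun z => g z + ε k * h z := fun k => by fun_prop
  choose Y hY hYmax using fun k => exists_convexConj_eq (hgε k) x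
  have hlow : ∀ k, -h y ≤ (convexConj (fun z => g z + ε k * h z) x - convexConj g x) / ε k := by
    intro k
    rw [le_div_iff₀ (hε k)]
    have := inner_sub_le_convexConj (hgε k) x y
    linarith
  have hup : ∀ k, (convexConj (fun z => g z + ε k * h z) x - convexConj g x) / ε k ≤ -h (Y k) := by
    intro k
    rw [div_le_iff₀ (hε k)]
    have h1 := hY k
    have h2 := inner_sub_le_convexConj hg x (Y k)
    linarith
  obtain ⟨C, hC⟩ := (isCompact_range hh).isBounded.exists_norm_le
  have hC' : ∀ z, |h z| ≤ C := fun z => hC _ (Set.mem_range_self z)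
  have hval : Filter.Tendsto (fun k => ⟪x, (Y k : E)⟫ - g (Y k)) Filter.atTop
      (𝓝 (convexConj g x)) := by
    have hl : Filter.Tendsto (fun k => convexConj g x - 2 * C * ε k) Filter.atTop
        (𝓝 (convexConj g x)) := by
      simpa using (tendsto_const_nhds (x := convexConj g x)).sub (hlim.const_mul (2 * C))
    refine tendsto_of_tendsto_of_tendsto_of_le_of_le hl tendsto_const_nhds (fun k => ?_)
      fun k => inner_sub_le_convexConj hg x (Y k)
    have h1 := hYmax k y
    have h2 := mul_le_mul_of_nonneg_left (abs_le.1 (hC' y)).2 (hε k).le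
    have h3 := mul_le_mul_of_nonneg_left (abs_le.1 (hC' (Y k))).1 (hε k).le
    simp only
    linarith
  have hYlim : Filter.Tendsto Y Filter.atTop (𝓝 y) := by
    refine le_nhds_of_unique_clusterPt fun y' hy' => huniq y' ?_
    have hcl : MapClusterPt (⟪x, (y' : E)⟫ - g y') Filter.atTop
        ((fun z : K => ⟪x, (z : E)⟫ - g z) ∘ Y) :=
      MapClusterPt.continuousAt_comp (f := fun z : K => ⟪x, (z : E)⟫ - g z)
        (Continuous.continuousAt (by fun_prop)) hy'
    have : (𝓝 (⟪x, (y' : E)⟫ - g y') ⊓ 𝓝 (convexConj g x)).NeBot :=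
      Filter.NeBot.mono hcl (inf_le_inf_left _ hval)
    exact (eq_of_nhds_neBot this).symm
  exact tendsto_of_tendsto_of_tendsto_of_le_of_le tendsto_const_nhds
    ((hh.tendsto y).comp hYlim).neg hlow hup

variable [MeasurableSpace E] [BorelSpace E] {m μ ν : Measure E} [m.IsAddHaarMeasure]
  [IsFiniteMeasure μ] [IsFiniteMeasure ν]

lemma measurable_gradient (f : E → ℝ) : Measurable (gradient f) :=
  (InnerProductSpace.toDual ℝ E).symm.continuous.measurable.comp (measurable_fderiv ℝ f)

omit [IsFiniteMeasure μ] in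
lemma ae_gradient_convexConj (hac : μ ≪ m) {g : K → ℝ} (hg : Continuous g) :
    ∀ᵐ x ∂μ, ∃ y : K, gradient (convexConj g) x = y ∧ convexConj g x = ⟪x, (y : E)⟫ - g y ∧
      ∀ y' : K, convexConj g x = ⟪x, (y' : E)⟫ - g y' → y' = y := by
  have hK : IsCompact K := isCompact_iff_compactSpace.2 inferInstance
  obtain ⟨R, hR⟩ := hK.isBounded.exists_norm_le
  have hlip := lipschitzWith_convexConj (R := R.toNNReal) hg
    fun y hy => (hR y hy).trans (Real.le_coe_toNNReal R)
  filter_upwards [hac.ae_le (hlip.ae_differentiableAt (μ := m))] with x hx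
  obtain ⟨y, hy, -⟩ := exists_convexConj_eq hg x
  exact ⟨y, gradient_convexConj_eq hg hx hy, hy, fun y' hy' => Subtype.ext <|
    (gradient_convexConj_eq hg hx hy').symm.trans (gradient_convexConj_eq hg hx hy)⟩

/-- First variation of the dual functional at a minimiser. -/
lemma integral_gradient_convexConj_le (hac : μ ≪ m) (hμ : ∀ᵐ x ∂μ, x ∈ K)
    {g : K → ℝ} (hg : Continuous g)
    (hmin : ∀ g' : K → ℝ, Continuous g' → dualFun μ ν g ≤ dualFun μ ν g')
    {h : E → ℝ} (hh : Continuous h) :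
    ∫ x, h (gradient (convexConj g) x) ∂μ ≤ ∫ y : K, h y ∂(ν.comap ((↑) : K → E)) := by
  have hK : IsCompact K := isCompact_iff_compactSpace.2 inferInstance
  have := isFiniteMeasure_comap_coe (K := K) (ν := ν)
  have hi : ∀ {f : K → ℝ}, Continuous f → Integrable f (ν.comap ((↑) : K → E)) := fun hf =>
    hf.integrable_of_hasCompactSupport (HasCompactSupport.of_compactSpace _)
  have hj := fun {f : E → ℝ} (hf : Continuous f) => integrable_of_continuous_of_ae_mem hK hμ hf
  set ε : ℕ → ℝ := fun k => 1 / ((k : ℝ) + 1) with hεdef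
  have hε : ∀ k, 0 < ε k := fun k => Nat.one_div_pos_of_nat
  have hh' : Continuous fun z : K => h z := hh.comp continuous_subtype_val
  have hgε : ∀ k, Continuous fun z : K => g z + ε k * h z := fun k => by fun_prop
  obtain ⟨C, hC⟩ := (isCompact_range hh').isBounded.exists_norm_le
  have hC' : ∀ z : K, |h z| ≤ C := fun z => hC _ (Set.mem_range_self z)
  set q : ℕ → E → ℝ := fun k x =>
    (convexConj (fun z : K => g z + ε k * h z) x - convexConj g x) / ε k with hq
  have hqc : ∀ k, Continuous (q k) := fun k =>
    ((continuous_convexConj (hgε k)).sub (continuous_convexConj hg)).div_const _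
  have hlim : Filter.Tendsto (fun k => ∫ x, q k x ∂μ) Filter.atTop
      (𝓝 (∫ x, -h (gradient (convexConj g) x) ∂μ)) := by
    refine tendsto_integral_of_dominated_convergence (fun _ => C)
      (fun k => (hqc k).aestronglyMeasurable) (integrable_const _) (fun k => ?_) ?_
    · refine Filter.Eventually.of_forall fun x => ?_
      rw [hq, Real.norm_eq_abs, abs_div, abs_of_pos (hε k), div_le_iff₀ (hε k), abs_le]
      have h1 := convexConj_le_add (hgε k) hg (δ := C * ε k) (fun y => by
        nlinarith [(abs_le.1 (hC' y)).1, hε k]) x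
      have h2 := convexConj_le_add hg (hgε k) (δ := C * ε k) (fun y => by
        nlinarith [(abs_le.1 (hC' y)).2, hε k]) x
      constructor <;> linarith
    · filter_upwards [ae_gradient_convexConj hac hg] with x ⟨y, hy1, hy2, hy3⟩
      rw [hy1]
      exact tendsto_convexConj_add_sub_div hg hh' hy2 hy3 hε
        tendsto_one_div_add_atTop_nhds_zero_nat
  have hnn : ∀ k, 0 ≤ ∫ x, q k x ∂μ + ∫ y : K, h y ∂(ν.comap ((↑) : K → E)) := by
    intro k
    have h1 := hmin _ (hgε k)
    unfold dualFun at h1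
    rw [integral_add (hi hg) ((hi hh').const_mul _), integral_const_mul] at h1
    rw [hq]
    simp only
    rw [integral_div, integral_sub (hj (continuous_convexConj (hgε k)))
      (hj (continuous_convexConj hg))]
    have h2 : 0 ≤ (∫ x, convexConj (fun z : K => g z + ε k * h z) x ∂μ -
      ∫ x, convexConj g x ∂μ + ε k * ∫ y : K, h y ∂(ν.comap ((↑) : K → E))) / ε k :=
      div_nonneg (by linarith) (hε k).le
    rwa [add_div, mul_div_cancel_left₀ _ (hε k).ne'] at h2
  have := ge_of_tendsto' (hlim.add_const _) hnn
  rw [integral_neg] at this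
  linarith

/-- Optimal transport map: on a compact set, from an absolutely continuous measure, there is a
map given by subgradients of a convex function which transports the first marginal of `π` on the
second one, at a quadratic cost at most that of `π`. -/
theorem exists_optimal_map {π : Measure (E × E)} [IsFiniteMeasure π]
    (hπ : ∀ᵐ p ∂π, p.1 ∈ K ∧ p.2 ∈ K) (hac : π.map Prod.fst ≪ m) :
    ∃ (u : E → ℝ) (L : ℝ≥0) (T : E → E), ConvexOn ℝ Set.univ u ∧ LipschitzWith L u ∧
      Measurable T ∧ (π.map Prod.fst).map T = π.map Prod.snd ∧
      (∀ᵐ x ∂(π.map Prod.fst), ∀ x', u x + ⟪T x, x' - x⟫ ≤ u x') ∧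
      ∫⁻ x, ENNReal.ofReal (‖x - T x‖ ^ 2) ∂(π.map Prod.fst) ≤
        ∫⁻ p, ENNReal.ofReal (‖p.1 - p.2‖ ^ 2) ∂π := by
  have hK : IsCompact K := isCompact_iff_compactSpace.2 inferInstance
  set μ := π.map Prod.fst with hμdef
  set ν := π.map Prod.snd with hνdef
  have hμ : ∀ᵐ x ∂μ, x ∈ K :=
    (ae_map_iff measurable_fst.aemeasurable hK.measurableSet).2 (hπ.mono fun p hp => hp.1)
  have hν : ∀ᵐ x ∂ν, x ∈ K :=
    (ae_map_iff measurable_snd.aemeasurable hK.measurableSet).2 (hπ.mono fun p hp => hp.2)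
  have hmass : μ.real Set.univ = (ν.comap ((↑) : K → E)).real Set.univ := by
    have h1 := integral_comap_coe_eq hK.measurableSet hν (fun _ => 1)
    simp only [integral_const, smul_eq_mul, mul_one] at h1
    rw [h1, hμdef, hνdef, map_measureReal_apply measurable_fst .univ,
      map_measureReal_apply measurable_snd .univ, Set.preimage_univ, Set.preimage_univ]
  obtain ⟨g, hg, hmin⟩ := exists_forall_dualFun_le (μ := μ) (ν := ν) hμ hmass
  obtain ⟨R, hR⟩ := hK.isBounded.exists_norm_le
  have hlip := lipschitzWith_convexConj (R := R.toNNReal) hg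
    fun y hy => (hR y hy).trans (Real.le_coe_toNNReal R)
  set u := convexConj g with hu
  set T := gradient u with hT
  have hTm : Measurable T := measurable_gradient u
  have hae := ae_gradient_convexConj hac hg
  have hint : ∀ h : E → ℝ, Continuous h → ∫ x, h (T x) ∂μ = ∫ y, h y ∂ν := by
    intro h hh
    rw [← integral_comap_coe_eq hK.measurableSet hν h]
    refine le_antisymm (integral_gradient_convexConj_le hac hμ hg hmin hh) ?_
    have := integral_gradient_convexConj_le hac hμ hg hmin hh.neg
    simp only [Pi.neg_apply, integral_neg] at this
    linarith
  have hmap : μ.map T = ν := by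
    refine ext_of_forall_integral_eq_of_IsFiniteMeasure fun h => ?_
    rw [integral_map hTm.aemeasurable h.continuous.aestronglyMeasurable]
    exact hint h h.continuous
  refine ⟨u, _, T, convexOn_convexConj hg, hlip, hTm, hmap, ?_, ?_⟩
  · filter_upwards [hae] with x ⟨y, hy1, hy2, _⟩ x'
    rw [hT, hu, hy1]
    exact subgradient_convexConj hg hy2 x'
  obtain ⟨V, hV⟩ := ContinuousMap.exists_restrict_eq hK.isClosed (⟨g, hg⟩ : C(K, ℝ))
  have hVg : ∀ y : K, V y = g y := fun y => congrArg (fun f : C(K, ℝ) => f y) hV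
  set a : E → ℝ := fun x => ‖x‖ ^ 2 - 2 * u x with ha
  set b : E → ℝ := fun y => ‖y‖ ^ 2 - 2 * V y with hb
  have hac' : Continuous a := (continuous_norm.pow 2).sub (continuous_const.mul hlip.continuous)
  have hbc : Continuous b := by fun_prop
  have hle : ∀ᵐ p ∂π, a p.1 + b p.2 ≤ ‖p.1 - p.2‖ ^ 2 := by
    filter_upwards [hπ] with p hp
    have := inner_sub_le_convexConj hg p.1 ⟨p.2, hp.2⟩
    rw [← hVg] at this
    rw [norm_sub_sq_real]
    linarith
  have heq : ∀ᵐ x ∂μ, ‖x - T x‖ ^ 2 = a x + b (T x) := by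
    filter_upwards [hae] with x ⟨y, hy1, hy2, _⟩
    rw [← hVg, ← hy1] at hy2
    rw [norm_sub_sq_real, ha, hb]
    simp only
    rw [hT, hu]
    linarith
  have ia : Integrable a μ := integrable_of_continuous_of_ae_mem hK hμ hac'
  have ib : Integrable b ν := integrable_of_continuous_of_ae_mem hK hν hbc
  have ibT : Integrable (fun x => b (T x)) μ := by
    rw [← hmap] at ib
    exact ib.comp_measurable hTm
  have ia' : Integrable (fun p : E × E => a p.1) π := ia.comp_measurable measurable_fst
  have ib' : Integrable (fun p : E × E => b p.2) π := ib.comp_measurable measurable_snd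
  have iT : Integrable (fun x => ‖x - T x‖ ^ 2) μ :=
    (ia.add ibT).congr (heq.mono fun x hx => hx.symm)
  have ip : Integrable (fun p : E × E => ‖p.1 - p.2‖ ^ 2) π := by
    have hc : Continuous fun p : E × E => ‖p.1 - p.2‖ ^ 2 := by fun_prop
    exact integrable_of_continuous_of_ae_mem (hK.prod hK) hπ hc
  rw [← ofReal_integral_eq_lintegral_ofReal iT (Filter.Eventually.of_forall fun _ => by positivity),
    ← ofReal_integral_eq_lintegral_ofReal ip (Filter.Eventually.of_forall fun _ => by positivity)]
  refine ENNReal.ofReal_le_ofReal ?_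
  calc ∫ x, ‖x - T x‖ ^ 2 ∂μ = ∫ x, a x ∂μ + ∫ x, b (T x) ∂μ := by
        rw [integral_congr_ae heq, integral_add ia ibT]
    _ = ∫ x, a x ∂μ + ∫ y, b y ∂ν := by rw [hint b hbc]
    _ = ∫ p, (a p.1 + b p.2) ∂π := by
        rw [integral_add ia' ib', hμdef, hνdef,
          integral_map measurable_fst.aemeasurable hac'.aestronglyMeasurable,
          integral_map measurable_snd.aemeasurable hbc.aestronglyMeasurable]
    _ ≤ ∫ p, ‖p.1 - p.2‖ ^ 2 ∂π := integral_mono_ae (ia'.add ib') ip hle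

end OptimalMap

section Estimate

lemma lintegral_rpow_interpolation {r s : ℝ} (hr : 0 < r) (hrs : r < s) :
    ∫⁻ t in Set.Ioo (0 : ℝ) 1, ENNReal.ofReal (r ^ (1 - t) * s ^ t) ^ (1 / 2 : ℝ) =
      ENNReal.ofReal (2 * (√s - √r) / Real.log (s / r)) := by
  have hs := hr.trans hrs
  set L := Real.log (s / r) with hL
  have hLpos : 0 < L := Real.log_pos ((one_lt_div hr).2 hrs)
  have hexp : ∀ t : ℝ, (r ^ (1 - t) * s ^ t) ^ (1 / 2 : ℝ) = √r * Real.exp (L / 2 * t) := by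
    intro t
    rw [Real.sqrt_eq_rpow, Real.rpow_def_of_pos hr, Real.rpow_def_of_pos hs,
      Real.rpow_def_of_pos hr, ← Real.exp_add, ← Real.exp_mul, ← Real.exp_add, hL,
      Real.log_div hs.ne' hr.ne']
    ring_nf
  have hend : Real.exp (L / 2) = √s / √r := by
    rw [← Real.sqrt_div hs.le, Real.sqrt_eq_rpow, Real.rpow_def_of_pos (div_pos hs hr), ← hL]
    ring_nf
  have hint : ∫ t in (0 : ℝ)..1, √r * Real.exp (L / 2 * t) = 2 * (√s - √r) / L := by
    have hd : ∀ t ∈ Set.uIcc (0 : ℝ) 1, HasDerivAt (fun t => 2 * √r / L * Real.exp (L / 2 * t))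
        (√r * Real.exp (L / 2 * t)) t := by
      intro t _
      have h : HasDerivAt (fun t => 2 * √r / L * Real.exp (L / 2 * t))
          (2 * √r / L * (Real.exp (L / 2 * t) * (L / 2 * 1))) t :=
        (((hasDerivAt_id t).const_mul (L / 2)).exp).const_mul (2 * √r / L)
      convert h using 1
      field_simp
    rw [intervalIntegral.integral_eq_sub_of_hasDerivAt hd
      (Continuous.intervalIntegrable (by fun_prop) _ _), mul_one, hend, mul_zero, Real.exp_zero]
    have : √r ≠ 0 := (Real.sqrt_pos.2 hr).ne'
    field_simp
  have hpos : ∀ t : ℝ, 0 ≤ √r * Real.exp (L / 2 * t) := fun t => by positivity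
  rw [← hint, intervalIntegral.integral_of_le zero_le_one, integral_Ioc_eq_integral_Ioo,
    ofReal_integral_eq_lintegral_ofReal]
  · refine lintegral_congr fun t => ?_
    rw [ENNReal.ofReal_rpow_of_nonneg (by positivity) (by norm_num), hexp]
  · have hc : Continuous fun t => √r * Real.exp (L / 2 * t) := by fun_prop
    exact (hc.integrableOn_Icc (a := 0) (b := 1)).mono_set Set.Ioo_subset_Icc_self
  · exact Filter.Eventually.of_forall hpos

variable {E : Type*} [NormedAddCommGroup E] [InnerProductSpace ℝ E] [FiniteDimensional ℝ E]

lemma continuous_gradient {f : E → ℝ} (hf : ContDiff ℝ 1 f) : Continuous (gradient f) :=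
  (InnerProductSpace.toDual ℝ E).symm.continuous.comp (hf.continuous_fderiv one_ne_zero)

lemma enorm_sub_le_lintegral_gradient {f : E → ℝ} (hf : ContDiff ℝ 1 f) (x y : E) :
    ‖f y - f x‖ₑ ≤
      ∫⁻ t in Set.Ioo (0 : ℝ) 1, ‖gradient f ((1 - t) • x + t • y)‖ₑ * ‖x - y‖ₑ := by
  have hd : ∀ t ∈ Set.uIcc (0 : ℝ) 1, HasDerivAt (fun t : ℝ => f ((1 - t) • x + t • y))
      ⟪gradient f ((1 - t) • x + t • y), y - x⟫ t := by
    intro t _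
    have h1 : HasDerivAt (fun t : ℝ => (1 - t) • x + t • y) (y - x) t := by
      have h : HasDerivAt (fun t : ℝ => (1 - t) • x + t • y) ((-1 : ℝ) • x + (1 : ℝ) • y) t :=
        (((hasDerivAt_id t).const_sub 1).smul_const x).add ((hasDerivAt_id t).smul_const y)
      rwa [neg_one_smul, one_smul, neg_add_eq_sub] at h
    have h2 := ((hf.differentiable one_ne_zero) ((1 - t) • x + t • y)).hasFDerivAt
    have h3 := h2.comp_hasDerivAt t h1
    rwa [← toDual_gradient] at h3
  have hc : Continuous fun t : ℝ => ⟪gradient f ((1 - t) • x + t • y), y - x⟫ := by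
    have := continuous_gradient hf
    fun_prop
  have h := intervalIntegral.integral_eq_sub_of_hasDerivAt hd (hc.intervalIntegrable _ _)
  simp only [sub_self, zero_smul, one_smul, zero_add, sub_zero, add_zero] at h
  rw [← h, intervalIntegral.integral_of_le zero_le_one, integral_Ioc_eq_integral_Ioo]
  refine (enorm_integral_le_lintegral_enorm _).trans (lintegral_mono fun t => ?_)
  rw [← ofReal_norm, ← ofReal_norm, ← ofReal_norm, ← ENNReal.ofReal_mul (norm_nonneg _),
    norm_sub_rev x y]
  exact ENNReal.ofReal_le_ofReal (norm_inner_le_norm _ _)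

variable [MeasurableSpace E] [BorelSpace E] {m : Measure E} [m.IsAddHaarMeasure] {r s : ℝ}

lemma enorm_sub_le_of_isCompact {π : Measure (E × E)} [IsFiniteMeasure π] {K : Set E}
    [CompactSpace K] [Nonempty K] (hπ : ∀ᵐ p ∂π, p.1 ∈ K ∧ p.2 ∈ K) (hr : 0 < r) (hrs : r < s)
    (hμ : π.map Prod.fst ≤ ENNReal.ofReal r • m) (hν : π.map Prod.snd ≤ ENNReal.ofReal s • m)
    {f : E → ℝ} (hf : ContDiff ℝ 1 f)
    (hf1 : ∫⁻ x, ENNReal.ofReal (‖gradient f x‖ ^ 2) ∂m ≤ 1) :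
    ‖∫ p, f p.2 ∂π - ∫ p, f p.1 ∂π‖ₑ ≤ ENNReal.ofReal (2 * (√s - √r) / Real.log (s / r)) *
      (∫⁻ p, ENNReal.ofReal (‖p.1 - p.2‖ ^ 2) ∂π) ^ (1 / 2 : ℝ) := by
  have hK : IsCompact K := isCompact_iff_compactSpace.2 inferInstance
  have hac : π.map Prod.fst ≪ m :=
    (Measure.absolutelyContinuous_of_le hμ).trans (Measure.AbsolutelyContinuous.rfl.smul_left _)
  obtain ⟨u, L, T, hu, huL, hT, hTmap, hsub, hcost⟩ := exists_optimal_map hπ hac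
  set μ := π.map Prod.fst with hμdef
  have hfc := hf.continuous
  have hgc := continuous_gradient hf
  have i1 : Integrable f μ := integrable_of_continuous_of_ae_mem hK
    ((ae_map_iff measurable_fst.aemeasurable hK.measurableSet).2 (hπ.mono fun p hp => hp.1)) hfc
  have i2 : Integrable f (μ.map T) := by
    rw [hTmap]
    exact integrable_of_continuous_of_ae_mem hK
      ((ae_map_iff measurable_snd.aemeasurable hK.measurableSet).2 (hπ.mono fun p hp => hp.2)) hfc
  have hsq : ∀ v : E, ENNReal.ofReal (‖v‖ ^ 2) = ‖v‖ₑ ^ (2 : ℝ) := fun v => by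
    rw [ENNReal.ofReal_pow (norm_nonneg _), ofReal_norm, ENNReal.rpow_ofNat]
  have hZ : ∀ t : ℝ, Measurable fun x => (1 - t) • x + t • T x := fun t =>
    (measurable_id.const_smul _).add (hT.const_smul _)
  have hgrad : ∀ t ∈ Set.Ioo (0 : ℝ) 1,
      ∫⁻ x, ‖gradient f ((1 - t) • x + t • T x)‖ₑ ^ (2 : ℝ) ∂μ ≤
      ENNReal.ofReal (r ^ (1 - t) * s ^ t) := by
    intro t ht
    have hle : μ.map (fun x => (1 - t) • x + t • T x) ≤
        ENNReal.ofReal (r ^ (1 - t) * s ^ t) • m := by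
      refine Measure.le_iff.2 fun A hA => ?_
      rw [Measure.map_apply (hZ t) hA, Measure.smul_apply, smul_eq_mul]
      exact measure_interpolation_preimage_le hr (hr.trans hrs) hμ hν hu huL hT hTmap hsub
        ht.1 ht.2 hA
    calc ∫⁻ x, ‖gradient f ((1 - t) • x + t • T x)‖ₑ ^ (2 : ℝ) ∂μ
        = ∫⁻ x, ‖gradient f x‖ₑ ^ (2 : ℝ) ∂(μ.map fun x => (1 - t) • x + t • T x) :=
          (lintegral_map (hgc.measurable.enorm.pow_const _) (hZ t)).symm
      _ ≤ ∫⁻ x, ‖gradient f x‖ₑ ^ (2 : ℝ) ∂(ENNReal.ofReal (r ^ (1 - t) * s ^ t) • m) :=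
          lintegral_mono' hle le_rfl
      _ ≤ ENNReal.ofReal (r ^ (1 - t) * s ^ t) := by
          rw [lintegral_smul_measure, smul_eq_mul]
          simp only [hsq] at hf1
          exact mul_le_of_le_one_right' hf1
  have hjoint : Measurable fun q : E × ℝ =>
      ‖gradient f ((1 - q.2) • q.1 + q.2 • T q.1)‖ₑ * ‖q.1 - T q.1‖ₑ := by
    have := hgc.measurable
    fun_prop
  calc ‖∫ p, f p.2 ∂π - ∫ p, f p.1 ∂π‖ₑ = ‖∫ x, (f (T x) - f x) ∂μ‖ₑ := by
        have i3 : Integrable (fun x => f (T x)) μ := i2.comp_measurable hT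
        rw [integral_sub i3 i1, ← integral_map hT.aemeasurable hfc.aestronglyMeasurable, hTmap,
          integral_map measurable_fst.aemeasurable hfc.aestronglyMeasurable,
          integral_map measurable_snd.aemeasurable hfc.aestronglyMeasurable]
    _ ≤ ∫⁻ x, ‖f (T x) - f x‖ₑ ∂μ := enorm_integral_le_lintegral_enorm _
    _ ≤ ∫⁻ x, (∫⁻ t in Set.Ioo (0 : ℝ) 1,
          ‖gradient f ((1 - t) • x + t • T x)‖ₑ * ‖x - T x‖ₑ) ∂μ :=
        lintegral_mono fun x => enorm_sub_le_lintegral_gradient hf x (T x)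
    _ = ∫⁻ t in Set.Ioo (0 : ℝ) 1, ∫⁻ x,
          ‖gradient f ((1 - t) • x + t • T x)‖ₑ * ‖x - T x‖ₑ ∂μ :=
        lintegral_lintegral_swap hjoint.aemeasurable
    _ ≤ ∫⁻ t in Set.Ioo (0 : ℝ) 1, ENNReal.ofReal (r ^ (1 - t) * s ^ t) ^ (1 / 2 : ℝ) *
          (∫⁻ p, ENNReal.ofReal (‖p.1 - p.2‖ ^ 2) ∂π) ^ (1 / 2 : ℝ) := by
        refine setLIntegral_mono' measurableSet_Ioo fun t ht => ?_
        refine (ENNReal.lintegral_mul_le_Lp_mul_Lq μ Real.HolderConjugate.two_two ?_ ?_).trans ?_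
        · exact (hgc.measurable.comp (hZ t)).enorm.aemeasurable
        · exact (measurable_id.sub hT).enorm.aemeasurable
        · refine mul_le_mul' (ENNReal.rpow_le_rpow (hgrad t ht) (by norm_num))
            (ENNReal.rpow_le_rpow ?_ (by norm_num))
          simp only [hsq] at hcost ⊢
          exact hcost
    _ = _ := by
        rw [lintegral_mul_const _ (by fun_prop), lintegral_rpow_interpolation hr hrs]

/-- The estimate for one coupling, by truncation to balls. -/
lemma enorm_integral_sub_integral_le {π : Measure (E × E)} [IsFiniteMeasure π]
    (hr : 0 < r) (hrs : r < s)
    (hμ : π.map Prod.fst ≤ ENNReal.ofReal r • m) (hν : π.map Prod.snd ≤ ENNReal.ofReal s • m)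
    {f : E → ℝ} (hf : ContDiff ℝ 1 f) {C : ℝ} (hC : ∀ x, |f x| ≤ C)
    (hf1 : ∫⁻ x, ENNReal.ofReal (‖gradient f x‖ ^ 2) ∂m ≤ 1) :
    ‖∫ p, f p.2 ∂π - ∫ p, f p.1 ∂π‖ₑ ≤ ENNReal.ofReal (2 * (√s - √r) / Real.log (s / r)) *
      (∫⁻ p, ENNReal.ofReal (‖p.1 - p.2‖ ^ 2) ∂π) ^ (1 / 2 : ℝ) := by
  set B : ℕ → Set (E × E) := fun k => Metric.closedBall 0 k ×ˢ Metric.closedBall 0 k with hB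
  have hBm : ∀ k, MeasurableSet (B k) := fun k =>
    Metric.isClosed_closedBall.measurableSet.prod Metric.isClosed_closedBall.measurableSet
  have hBmono : Monotone B := fun k l hkl => by
    have h := Metric.closedBall_subset_closedBall (x := (0 : E)) (Nat.cast_le (α := ℝ).2 hkl)
    exact Set.prod_mono h h
  have hBU : ⋃ k, B k = Set.univ := by
    refine Set.eq_univ_of_forall fun p => ?_
    obtain ⟨k, hk⟩ := exists_nat_ge (max ‖p.1‖ ‖p.2‖)
    exact Set.mem_iUnion.2 ⟨k, by simpa [hB] using max_le_iff.1 hk⟩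
  have hlim : ∀ {φ : E × E → ℝ}, Integrable φ π →
      Filter.Tendsto (fun k => ∫ p in B k, φ p ∂π) Filter.atTop (𝓝 (∫ p, φ p ∂π)) := by
    intro φ hφ
    have h := tendsto_setIntegral_of_monotone hBm hBmono hφ.integrableOn
    rwa [hBU, setIntegral_univ] at h
  have i1 : Integrable (fun p : E × E => f p.1) π := Integrable.of_bound
    (hf.continuous.comp continuous_fst).aestronglyMeasurable C
    (Filter.Eventually.of_forall fun p => hC p.1)
  have i2 : Integrable (fun p : E × E => f p.2) π := Integrable.of_bound
    (hf.continuous.comp continuous_snd).aestronglyMeasurable C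
    (Filter.Eventually.of_forall fun p => hC p.2)
  refine le_of_tendsto (((hlim i2).sub (hlim i1)).enorm) (Filter.Eventually.of_forall fun k => ?_)
  have hcomp : CompactSpace (Metric.closedBall (0 : E) k) :=
    isCompact_iff_compactSpace.1 (isCompact_closedBall _ _)
  have hne : Nonempty (Metric.closedBall (0 : E) k) := ⟨0, by simp⟩
  have hmem : ∀ᵐ p ∂(π.restrict (B k)),
      p.1 ∈ Metric.closedBall (0 : E) k ∧ p.2 ∈ Metric.closedBall (0 : E) k :=
    ae_restrict_mem (hBm k)
  refine (enorm_sub_le_of_isCompact hmem hr hrs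
    ((Measure.map_mono Measure.restrict_le_self measurable_fst).trans hμ)
    ((Measure.map_mono Measure.restrict_le_self measurable_snd).trans hν) hf hf1).trans ?_
  gcongr
  exact Measure.restrict_le_self

end Estimate

/-- If `μ ≤ ρ₀·λ` and `ν ≤ ρ₁·λ` with `0 < ρ₀ < ρ₁` and `μ, ν` are finite measures with
the same total mass, then
`‖ν − μ‖_{Ḣ⁻¹} ≤ (2(√ρ₁ − √ρ₀)/ln(ρ₁/ρ₀)) · W₂(μ, ν)`. -/
theorem HminusOne_le_W2_of_upperDensityBounds {n : ℕ}
    (μ ν : Measure (EuclideanSpace ℝ (Fin n)))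
    [IsFiniteMeasure μ] [IsFiniteMeasure ν] (hmass : μ Set.univ = ν Set.univ)
    (ρ₀ ρ₁ : ℝ) (hρ₀ : 0 < ρ₀) (hρ : ρ₀ < ρ₁)
    (hμ : μ ≤ ENNReal.ofReal ρ₀ • volume) (hν : ν ≤ ENNReal.ofReal ρ₁ • volume) :
    HminusOneDiff volume μ ν ≤
      ENNReal.ofReal (2 * (Real.sqrt ρ₁ - Real.sqrt ρ₀) / Real.log (ρ₁ / ρ₀)) * W2 μ ν := by
  refine iSup₂_le fun f hf => ?_
  obtain ⟨⟨C, hC⟩, hfd, hf1⟩ := hf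
  set c := ENNReal.ofReal (2 * (Real.sqrt ρ₁ - Real.sqrt ρ₀) / Real.log (ρ₁ / ρ₀)) with hc
  have hc0 : c ≠ 0 := by
    have h1 := Real.log_pos ((one_lt_div hρ₀).2 hρ)
    have h2 := sub_pos.2 (Real.sqrt_lt_sqrt hρ₀.le hρ)
    exact (ENNReal.ofReal_pos.2 (by positivity)).ne'
  rw [← Real.norm_eq_abs, ofReal_norm, W2, mul_comm, ← ENNReal.div_le_iff hc0 ENNReal.ofReal_ne_top,
    one_div, ENNReal.le_rpow_inv_iff two_pos]
  refine le_iInf₂ fun π hπ => ?_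
  obtain ⟨rfl, rfl⟩ := hπ
  have hfin : IsFiniteMeasure π := ⟨by
    have h := measure_lt_top (π.map Prod.fst) Set.univ
    rwa [Measure.map_apply measurable_fst .univ, Set.preimage_univ] at h⟩
  rw [← ENNReal.le_rpow_inv_iff two_pos, ENNReal.div_le_iff hc0 ENNReal.ofReal_ne_top, mul_comm,
    ← one_div, integral_map measurable_fst.aemeasurable hfd.continuous.aestronglyMeasurable,
    integral_map measurable_snd.aemeasurable hfd.continuous.aestronglyMeasurable]
  exact enorm_integral_sub_integral_le hρ₀ hρ hμ hν hfd hC hf1
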